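/- Let E be a real normed vector space, let A be a normed ℝ-algebra (so that ‖x·y‖ ≤ ‖x‖·‖y‖ for all x, y ∈ A), let V ⊆ E be a nonempty compact set, and let f, g : E → A be smooth (ContDiff of order ∞). For each i ≥ 0 set p_i(f) = sup_{x ∈ V} ‖iteratedFDeriv ℝ i f x‖, and for each n ≥ 0 set q_n(f) = Σ_{i=0}^{n} p_i(f)/i!. Then for every n, q_n(f·g) ≤ q_n(f)·q_n(g), i.e. the seminorms q_n are submultiplicative. -/

import Mathlib

theorem sum_range_cauchyProduct_le {a b : ℕ → ℝ} (ha : ∀ i, 0 ≤ a i) (hb : ∀ i, 0 ≤ b i)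
    (n : ℕ) :
    ∑ i ∈ Finset.range n, ∑ j ∈ Finset.range (i + 1), a j * b (i - j)
      ≤ (∑ i ∈ Finset.range n, a i) * ∑ i ∈ Finset.range n, b i := by
  rw [Finset.sum_range_diag_flip n fun j k => a j * b k, Finset.sum_mul_sum]
  refine Finset.sum_le_sum fun i _ => Finset.sum_le_sum_of_subset_of_nonneg ?_ ?_
  · exact Finset.range_mono (Nat.sub_le n i)
  · exact fun j _ _ => mul_nonneg (ha i) (hb j)

theorem ContDiff.norm_iteratedFDeriv_le_iSup {E F : Type*} [NormedAddCommGroup E]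
    [NormedSpace ℝ E] [NormedAddCommGroup F] [NormedSpace ℝ F] {V : Set E} (hV : IsCompact V)
    {f : E → F} {i : ℕ} (hf : ContDiff ℝ i f) (x : V) :
    ‖iteratedFDeriv ℝ i f (x : E)‖ ≤ ⨆ y : V, ‖iteratedFDeriv ℝ i f (y : E)‖ := by
  have hc : Continuous fun y => ‖iteratedFDeriv ℝ i f y‖ :=
    (hf.continuous_iteratedFDeriv le_rfl).norm
  refine le_ciSup (f := fun y : V => ‖iteratedFDeriv ℝ i f (y : E)‖) ?_ x
  simpa only [Set.image_eq_range] using hV.bddAbove_image hc.continuousOn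

/-- Submultiplicativity of the seminorms `q_n(f) = ∑_{i=0}^n (sup_{x ∈ V} ‖D^i f(x)‖)/i!`
on smooth `A`-valued functions on a real normed space `E`, where `V` is a nonempty
compact subset of `E` and `A` is a normed `ℝ`-algebra. -/
theorem seminorms_q_submultiplicative
    {E A : Type*} [NormedAddCommGroup E] [NormedSpace ℝ E]
    [NormedRing A] [NormedAlgebra ℝ A]
    (V : Set E) (hne : V.Nonempty) (hcpt : IsCompact V)
    (f g : E → A) (hf : ContDiff ℝ (⊤ : ℕ∞) f) (hg : ContDiff ℝ (⊤ : ℕ∞) g) (n : ℕ) :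
    ∑ i ∈ Finset.range (n + 1),
        (⨆ x : V, ‖iteratedFDeriv ℝ i (fun y => f y * g y) (x : E)‖) / (Nat.factorial i : ℝ)
      ≤ (∑ i ∈ Finset.range (n + 1),
            (⨆ x : V, ‖iteratedFDeriv ℝ i f (x : E)‖) / (Nat.factorial i : ℝ)) *
        (∑ i ∈ Finset.range (n + 1),
            (⨆ x : V, ‖iteratedFDeriv ℝ i g (x : E)‖) / (Nat.factorial i : ℝ)) := by
  have hsmooth (i : ℕ) : (i : WithTop ℕ∞) ≤ ((⊤ : ℕ∞) : WithTop ℕ∞) := by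
    exact_mod_cast le_top
  have : Nonempty V := hne.to_subtype
  have hnonneg (h : E → A) (i : ℕ) : 0 ≤ ⨆ x : V, ‖iteratedFDeriv ℝ i h (x : E)‖ :=
    Real.iSup_nonneg fun _ => norm_nonneg _
  refine le_trans (Finset.sum_le_sum fun i _ => ?_)
    (sum_range_cauchyProduct_le (fun i => div_nonneg (hnonneg f i) (Nat.cast_nonneg _))
      (fun i => div_nonneg (hnonneg g i) (Nat.cast_nonneg _)) (n + 1))
  rw [div_le_iff₀ (Nat.cast_pos.mpr i.factorial_pos), Finset.sum_mul]
  refine ciSup_le fun x => (norm_iteratedFDeriv_mul_le hf hg (x : E) (hsmooth i)).trans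
    (Finset.sum_le_sum fun j hj => ?_)
  have hfj := (hf.of_le (hsmooth j)).norm_iteratedFDeriv_le_iSup hcpt x
  have hgj := (hg.of_le (hsmooth (i - j))).norm_iteratedFDeriv_le_iSup hcpt x
  calc
    _ ≤ (i.choose j : ℝ) * (⨆ y : V, ‖iteratedFDeriv ℝ j f (y : E)‖) *
        ⨆ y : V, ‖iteratedFDeriv ℝ (i - j) g (y : E)‖ := by
      have := hnonneg f j
      gcongr
    _ = _ := by
      rw [Nat.cast_choose ℝ (Finset.mem_range_succ_iff.mp hj)]
      field_simp
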